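/- For every integer k ≥ 2 and every positive integer n, log τ_k(n) / n ≤ (log k)/2, and equality holds for n = 2; consequently max_{n ≥ 1} (log τ_k(n))/n = (log k)/2. -/

import Mathlib

/-- `tauk k n` is the number of ordered `k`-tuples `(d 0, …, d (k-1))` of positive
integers whose product is `n` (the multidimensional divisor function `τ_k`). -/
noncomputable def tauk (k n : ℕ) : ℕ :=
  Nat.card {d : Fin k → ℕ // (∀ i, 0 < d i) ∧ ∏ i, d i = n}

theorem exists_mul_update_of_prod_eq {k p a : ℕ} (hp : p.Prime) {d : Fin k → ℕ}
    (hd : ∀ i, 0 < d i) (h : ∏ i, d i = p * a) :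
    ∃ (i : Fin k) (e : Fin k → ℕ), ((∀ j, 0 < e j) ∧ ∏ j, e j = a) ∧
      Function.update e i (p * e i) = d := by
  obtain ⟨i, -, c, hc⟩ := (hp.prime.dvd_finsetProd_iff d).1 (h ▸ Dvd.intro a rfl)
  refine ⟨i, Function.update d i c, ⟨fun j => ?_, ?_⟩, ?_⟩
  · rcases eq_or_ne j i with rfl | hj
    · have := hd j
      rw [hc] at this
      simpa using Nat.pos_of_mul_pos_left this
    · simpa [hj] using hd j
  · apply Nat.eq_of_mul_eq_mul_left hp.pos
    rw [← h, Finset.prod_update_of_mem (Finset.mem_univ i), ← mul_assoc, ← hc,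
      ← Finset.mul_prod_erase Finset.univ d (Finset.mem_univ i), Finset.sdiff_singleton_eq_erase]
  · simp [← hc]

theorem finite_and_tauk_le_pow_log (k n : ℕ) (hk : 1 ≤ k) (hn : n ≠ 0) :
    Finite {d : Fin k → ℕ // (∀ i, 0 < d i) ∧ ∏ i, d i = n} ∧ tauk k n ≤ k ^ Nat.log 2 n := by
  induction n using induction_on_primes with
  | zero => exact absurd rfl hn
  | one =>
    have : Subsingleton {d : Fin k → ℕ // (∀ i, 0 < d i) ∧ ∏ i, d i = 1} := by
      refine ⟨fun x y => Subtype.ext (funext fun i => ?_)⟩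
      rw [Finset.prod_eq_one_iff.1 x.2.2 i (Finset.mem_univ i),
        Finset.prod_eq_one_iff.1 y.2.2 i (Finset.mem_univ i)]
    exact ⟨inferInstance, by simpa [tauk] using Finite.card_le_one_iff_subsingleton.2 this⟩
  | prime_mul p a hp ih =>
    have ha : a ≠ 0 := right_ne_zero_of_mul hn
    obtain ⟨hfin, hle⟩ := ih ha
    let f : Fin k × {d : Fin k → ℕ // (∀ i, 0 < d i) ∧ ∏ i, d i = a} → Fin k → ℕ :=
      fun x => Function.update x.2.1 x.1 (p * x.2.1 x.1)
    have hsub : {d : Fin k → ℕ | (∀ i, 0 < d i) ∧ ∏ i, d i = p * a} ⊆ Set.range f := by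
      rintro d ⟨hd, h⟩
      obtain ⟨i, e, he, rfl⟩ := exists_mul_update_of_prod_eq hp hd h
      exact ⟨(i, ⟨e, he⟩), rfl⟩
    refine ⟨(Set.finite_range f).subset hsub, ?_⟩
    calc tauk k (p * a) ≤ Nat.card (Set.range f) := Nat.card_mono (Set.finite_range f) hsub
      _ ≤ k * tauk k a := by
        simpa [Nat.card_prod, tauk] using Finite.card_range_le f
      _ ≤ k * k ^ Nat.log 2 a := Nat.mul_le_mul_left k hle
      _ = k ^ (Nat.log 2 (a * 2)) := by rw [Nat.log_mul_base one_lt_two ha, pow_succ']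
      _ ≤ k ^ Nat.log 2 (p * a) := by
        refine Nat.pow_le_pow_right hk (Nat.log_mono_right ?_)
        rw [mul_comm]
        exact Nat.mul_le_mul_right a hp.two_le

theorem tauk_two (k : ℕ) (hk : 1 ≤ k) : tauk k 2 = k := by
  obtain ⟨hfin, hle⟩ := finite_and_tauk_le_pow_log k 2 hk two_ne_zero
  refine le_antisymm (hle.trans_eq ?_) ?_
  · rw [Nat.log_eq_one_iff'.2 (by norm_num), pow_one]
  let f : Fin k → {d : Fin k → ℕ // (∀ i, 0 < d i) ∧ ∏ i, d i = 2} := fun i =>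
    ⟨Function.update 1 i 2, fun j => by by_cases hj : j = i <;> simp [hj],
      by simp [Finset.prod_update_of_mem]⟩
  have hf : Function.Injective f := fun i j h => by
    have := congrFun (Subtype.ext_iff.1 h) i
    by_contra hij
    simp [f, hij] at this
  simpa [tauk] using Nat.card_le_card_of_injective f hf

theorem two_mul_log_two_le (n : ℕ) (hn : n ≠ 0) : 2 * Nat.log 2 n ≤ n := by
  refine le_trans ?_ (Nat.pow_log_le_self 2 hn)
  rcases Nat.log 2 n with _ | m
  · simp
  · have := m.lt_two_pow_self
    rw [pow_succ]
    omega

theorem log_tauk_div_le (k n : ℕ) (hk : 1 ≤ k) (hn : 1 ≤ n) :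
    Real.log (tauk k n) / n ≤ Real.log k / 2 := by
  have hlogk : 0 ≤ Real.log k := Real.log_natCast_nonneg k
  rcases Nat.eq_zero_or_pos (tauk k n) with h0 | hpos
  · rw [h0]
    simp only [Nat.cast_zero, Real.log_zero, zero_div]
    positivity
  have h1 : Real.log (tauk k n) ≤ Nat.log 2 n * Real.log k := by
    rw [← Real.log_pow]
    exact Real.log_le_log (by exact_mod_cast hpos)
      (by exact_mod_cast (finite_and_tauk_le_pow_log k n hk (by omega)).2)
  have h2 : (2 * Nat.log 2 n : ℝ) ≤ n := by exact_mod_cast two_mul_log_two_le n (by omega)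
  rw [div_le_div_iff₀ (by exact_mod_cast hn) two_pos]
  nlinarith [mul_le_mul_of_nonneg_right h2 hlogk]

/-- For `k ≥ 2` and `n ≥ 1`, `log τ_k(n) / n ≤ (log k)/2`, with
equality at `n = 2`; consequently `max_{n ≥ 1} (log τ_k(n))/n = (log k)/2`. -/
theorem max_log_tauk (k : ℕ) (hk : 2 ≤ k) :
    (∀ n : ℕ, 1 ≤ n → Real.log (tauk k n) / n ≤ Real.log k / 2) ∧
    Real.log (tauk k 2) / 2 = Real.log k / 2 ∧
    IsGreatest {x : ℝ | ∃ n : ℕ, 1 ≤ n ∧ x = Real.log (tauk k n) / n} (Real.log k / 2) := by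
  have hk1 : 1 ≤ k := by omega
  refine ⟨fun n => log_tauk_div_le k n hk1, by rw [tauk_two k hk1], ⟨2, one_le_two, ?_⟩, ?_⟩
  · rw [tauk_two k hk1, Nat.cast_ofNat]
  · rintro x ⟨n, hn, rfl⟩
    exact log_tauk_div_le k n hk1 hn
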